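/- Let U ⊆ ℝ^m be open, ρ : U → ℝ a nowhere-zero C¹ function, and let X₁,…,Xₙ (n ≤ m) be C¹ vector fields on U that pairwise commute ([X_a,X_b] = 0 for all a,b) and are each divergence free with respect to ω = ρ dx₁∧⋯∧dx_m (i.e. ∑_{j=1}^m ∂_j(ρ X_a^j) = 0 on U for each a). Then the (m−n)-form β = (X₁∧⋯∧Xₙ) ⌟ ω is closed; equivalently, in components: for every strictly increasing tuple 1 ≤ i₁ < ⋯ < i_{n−1} ≤ m one has ∑_{j=1}^m ∂_j( ρ · det A(j,i₁,…,i_{n−1}) ) = 0 on U, where A(k₁,…,kₙ) denotes the n×n matrix whose (a,b) entry is X_a^{k_b} (the b-th listed component of the field X_a). -/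

import Mathlib

open scoped BigOperators

/-- Partial derivative of `f` in the `j`-th coordinate direction. -/
noncomputable def pd {m : ℕ} (f : (Fin m → ℝ) → ℝ) (j : Fin m) (x : Fin m → ℝ) : ℝ :=
  fderiv ℝ f x (Pi.single j 1)

section PartialDerivatives

variable {m : ℕ} {f g : (Fin m → ℝ) → ℝ} {x : Fin m → ℝ}

theorem pd_mul (hf : DifferentiableAt ℝ f x) (hg : DifferentiableAt ℝ g x) (j : Fin m) :
    pd (fun y => f y * g y) j x = pd f j x * g x + f x * pd g j x := by
  simp only [pd, fderiv_fun_mul hf hg, add_apply,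
    smul_apply, smul_eq_mul]
  ring

theorem pd_const_mul (c : ℝ) (hf : DifferentiableAt ℝ f x) (j : Fin m) :
    pd (fun y => c * f y) j x = c * pd f j x := by
  simp [pd, fderiv_const_mul hf c]

theorem pd_sum {ι : Type*} {s : Finset ι} {F : ι → (Fin m → ℝ) → ℝ}
    (hF : ∀ k ∈ s, DifferentiableAt ℝ (F k) x) (j : Fin m) :
    pd (fun y => ∑ k ∈ s, F k y) j x = ∑ k ∈ s, pd (F k) j x := by
  simp [pd, fderiv_fun_sum hF]

theorem pd_prod {ι : Type*} [DecidableEq ι] {s : Finset ι} {F : ι → (Fin m → ℝ) → ℝ}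
    (hF : ∀ k ∈ s, DifferentiableAt ℝ (F k) x) (j : Fin m) :
    pd (fun y => ∏ k ∈ s, F k y) j x = ∑ k ∈ s, (∏ l ∈ s.erase k, F l x) * pd (F k) j x := by
  simp [pd, fderiv_finsetProd hF]

end PartialDerivatives

/-- For symmetric `D`, the terms of `σ` and `σ * swap 0 k.succ` cancel. -/
theorem sum_perm_sign_mul_prod_erase_mul_eq_zero {n : ℕ} {ι : Type*}
    (D : Fin (n + 1) → Fin (n + 1) → ι → ℝ) (hD : ∀ a b i, D a b i = D b a i)
    (v : Fin (n + 1) → ι → ℝ) (i : Fin n → ι) (k : Fin n) :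
    ∑ σ : Equiv.Perm (Fin (n + 1)), ((Equiv.Perm.sign σ : ℤ) : ℝ) *
      ((∏ l ∈ Finset.univ.erase k, v (σ l.succ) (i l)) * D (σ 0) (σ k.succ) (i k)) = 0 := by
  refine self_eq_neg.mp ?_
  rw [← Finset.sum_neg_distrib]
  refine Fintype.sum_equiv (Equiv.mulRight (Equiv.swap 0 k.succ)) _ _ fun σ => ?_
  have hprod : ∏ l ∈ Finset.univ.erase k, v ((σ * Equiv.swap 0 k.succ) l.succ) (i l) =
      ∏ l ∈ Finset.univ.erase k, v (σ l.succ) (i l) := by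
    refine Finset.prod_congr rfl fun l hl => ?_
    rw [Equiv.Perm.mul_apply, Equiv.swap_apply_of_ne_of_ne (Fin.succ_ne_zero l)
      (fun h => Finset.ne_of_mem_erase hl (Fin.succ_injective n h))]
  simp only [Equiv.coe_mulRight, hprod]
  simp [Equiv.Perm.sign_mul, Equiv.Perm.sign_swap (Fin.succ_ne_zero k).symm,
    hD (σ 0) (σ k.succ)]

/-- If `X₁,…,X_{n+1}` (with `n+1 ≤ m`) are C¹ vector fields on the open set
`U ⊆ ℝ^m` which pairwise commute and are each divergence free with respect to the
volume form `ω = ρ dx₁∧⋯∧dx_m` (`ρ` nowhere-zero C¹), then the `(m-(n+1))`-form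
`β = (X₁∧⋯∧X_{n+1}) ⌟ ω` is closed; in components: for every strictly increasing
`n`-tuple `i` of indices, `∑_j ∂_j (ρ · det A(j,i₁,…,iₙ)) = 0` on `U`, where
`A(k₀,…,kₙ)` is the square matrix with `(a,b)` entry `X_a^{k_b}`. -/
theorem divergence_free_web_closed_form
    {m n : ℕ} (hnm : n + 1 ≤ m)
    (U : Set (Fin m → ℝ)) (hU : IsOpen U)
    (ρ : (Fin m → ℝ) → ℝ) (hρ : ContDiffOn ℝ 1 ρ U) (hρ0 : ∀ x ∈ U, ρ x ≠ 0)
    (X : Fin (n + 1) → (Fin m → ℝ) → (Fin m → ℝ))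
    (hX : ∀ a, ContDiffOn ℝ 1 (X a) U)
    (hcomm : ∀ a b, ∀ x ∈ U, ∀ i : Fin m,
      ∑ j, (X a x j * pd (fun y => X b y i) j x
            - X b x j * pd (fun y => X a y i) j x) = 0)
    (hdiv : ∀ a, ∀ x ∈ U, ∑ j, pd (fun y => ρ y * X a y j) j x = 0) :
    ∀ x ∈ U, ∀ i : Fin n → Fin m, StrictMono i →
      ∑ j : Fin m,
        pd (fun y => ρ y *
          Matrix.det (Matrix.of fun a b : Fin (n + 1) => X a y (Matrix.vecCons j i b))) j x = 0 := by
  intro x hx i _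
  have hρx : DifferentiableAt ℝ ρ x :=
    (hρ.contDiffAt (hU.mem_nhds hx)).differentiableAt one_ne_zero
  have hXx : ∀ a k, DifferentiableAt ℝ (fun y => X a y k) x := fun a =>
    differentiableAt_pi.mp (((hX a).contDiffAt (hU.mem_nhds hx)).differentiableAt one_ne_zero)
  have hP : ∀ σ : Equiv.Perm (Fin (n + 1)),
      DifferentiableAt ℝ (fun y => ∏ k, X (σ k.succ) y (i k)) x :=
    fun σ =>
      (HasFDerivAt.finsetProd fun k _ => (hXx (σ k.succ) (i k)).hasFDerivAt).differentiableAt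
  have hterm : ∀ (σ : Equiv.Perm (Fin (n + 1))) j, DifferentiableAt ℝ
      (fun y => (ρ y * X (σ 0) y j) * ∏ k, X (σ k.succ) y (i k)) x :=
    fun σ j => (hρx.fun_mul (hXx _ _)).fun_mul (hP σ)
  have hdet : ∀ j, (fun y => ρ y *
      Matrix.det (Matrix.of fun a b : Fin (n + 1) => X a y (Matrix.vecCons j i b))) =
      fun y => ∑ σ : Equiv.Perm (Fin (n + 1)), ((Equiv.Perm.sign σ : ℤ) : ℝ) *
        ((ρ y * X (σ 0) y j) * ∏ k, X (σ k.succ) y (i k)) := by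
    intro j
    funext y
    rw [Matrix.det_apply', Finset.mul_sum]
    refine Finset.sum_congr rfl fun σ _ => ?_
    simp only [Fin.prod_univ_succ, Matrix.of_apply, Matrix.cons_val_zero, Matrix.cons_val_succ]
    ring
  let D : Fin (n + 1) → Fin (n + 1) → Fin m → ℝ :=
    fun a b k => ∑ j, X a x j * pd (fun y => X b y k) j x
  have hD : ∀ a b k, D a b k = D b a k := fun a b k => by
    simpa only [D, Finset.sum_sub_distrib, sub_eq_zero] using hcomm a b x hx k
  have hσ : ∀ σ : Equiv.Perm (Fin (n + 1)),
      ∑ j, pd (fun y => (ρ y * X (σ 0) y j) * ∏ k, X (σ k.succ) y (i k)) j x =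
        ρ x * ∑ k, (∏ l ∈ Finset.univ.erase k, X (σ l.succ) x (i l)) *
          D (σ 0) (σ k.succ) (i k) := by
    intro σ
    simp only [pd_mul (hρx.fun_mul (hXx _ _)) (hP σ)]
    rw [Finset.sum_add_distrib, ← Finset.sum_mul, hdiv _ x hx, zero_mul, zero_add]
    simp only [pd_prod (fun k _ => hXx (σ (Fin.succ k)) (i k)), D, Finset.mul_sum]
    rw [Finset.sum_comm]
    refine Finset.sum_congr rfl fun k _ => Finset.sum_congr rfl fun j _ => ?_
    ring
  simp only [hdet, pd_sum (fun σ _ => (hterm σ _).const_mul _), pd_const_mul _ (hterm _ _)]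
  rw [Finset.sum_comm]
  simp only [← Finset.mul_sum, hσ, mul_left_comm _ (ρ x)]
  simp only [Finset.mul_sum]
  rw [Finset.sum_comm]
  refine Finset.sum_eq_zero fun k _ => ?_
  rw [← Finset.mul_sum, sum_perm_sign_mul_prod_erase_mul_eq_zero D hD (fun a => X a x) i k,
    mul_zero]
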